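/- arXiv:1409.0370 — 2 statements merged into one kernel-verified Lean document; each statement's English description precedes it below -/
import Mathlib

section
/- Let γ = (a b; c d) ∈ SL₂(ℝ) with c ≠ 0, let r ∈ ℝ, and let τ, z ∈ ℍ. Then (γτ − γ(z̄))^{−r} · (cτ + d)^{−r} · (c·z̄ + d)^{−r} = (τ − z̄)^{−r}, where z̄ is the complex conjugate of z, γw = (aw + b)/(cw + d) is the Möbius action, and all powers are principal powers. -/
open Complex

noncomputable section

/-- The automorphy factor `j(γ, z) = c z + d` for `γ = (a b; c d) ∈ SL₂(ℝ)`. -/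
def jfac (γ : Matrix.SpecialLinearGroup (Fin 2) ℝ) (z : ℂ) : ℂ :=
  (γ.1 1 0 : ℝ) * z + (γ.1 1 1 : ℝ)

/-- The Möbius action `γ z = (a z + b)/(c z + d)`. -/
def moeb (γ : Matrix.SpecialLinearGroup (Fin 2) ℝ) (z : ℂ) : ℂ :=
  ((γ.1 0 0 : ℝ) * z + (γ.1 0 1 : ℝ)) / jfac γ z

theorem arg_pos_of_im_pos {z : ℂ} (hz : 0 < z.im) : 0 < arg z :=
  (arg_nonneg_iff.2 hz.le).lt_of_ne' fun h => hz.ne' (arg_eq_zero_iff.1 h).2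

theorem arg_lt_pi_of_im_pos {z : ℂ} (hz : 0 < z.im) : arg z < Real.pi :=
  arg_lt_pi_iff.2 (Or.inr hz.ne')

theorem abs_arg_add_arg_lt_pi {p q : ℂ} (h : p.im * q.im < 0) : |arg p + arg q| < Real.pi := by
  rw [abs_lt]
  rcases mul_neg_iff.1 h with ⟨hp, hq⟩ | ⟨hp, hq⟩
  · have := arg_pos_of_im_pos hp
    have := arg_lt_pi_of_im_pos hp
    have := arg_neg_iff.2 hq
    have := neg_pi_lt_arg q
    constructor <;> linarith
  · have := arg_pos_of_im_pos hq
    have := arg_lt_pi_of_im_pos hq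
    have := arg_neg_iff.2 hp
    have := neg_pi_lt_arg p
    constructor <;> linarith

theorem log_add_log_add_log_eq_log_mul {w p q : ℂ} (hw : 0 < w.im) (hpq : p.im * q.im < 0)
    (hu : 0 < (w * p * q).im) : log w + log p + log q = log (w * p * q) := by
  have hu0 : w * p * q ≠ 0 := fun h => by simp [h] at hu
  have hq0 : q ≠ 0 := right_ne_zero_of_mul hu0
  have hp0 : p ≠ 0 := right_ne_zero_of_mul (left_ne_zero_of_mul hu0)
  have hw0 : w ≠ 0 := left_ne_zero_of_mul (left_ne_zero_of_mul hu0)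
  have hexp : exp (log w + log p + log q) = exp (log (w * p * q)) := by
    rw [exp_add, exp_add, exp_log hw0, exp_log hp0, exp_log hq0, exp_log hu0]
  obtain ⟨n, hn⟩ := exp_eq_exp_iff_exists_int.1 hexp
  have him : arg w + arg p + arg q = arg (w * p * q) + n * (2 * Real.pi) := by
    simpa [log_im] using congrArg im hn
  obtain ⟨h₁, h₂⟩ := abs_lt.1 (abs_arg_add_arg_lt_pi hpq)
  have h₃ := arg_pos_of_im_pos hw
  have h₄ := arg_lt_pi_of_im_pos hw
  have h₅ := arg_pos_of_im_pos hu
  have h₆ := arg_lt_pi_of_im_pos hu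
  have hlt : (n : ℝ) < 1 := by nlinarith [Real.pi_pos]
  have hgt : (-1 : ℝ) < n := by nlinarith [Real.pi_pos]
  have hn0 : n = 0 := by
    have : n < 1 := by exact_mod_cast hlt
    have : -1 < n := by exact_mod_cast hgt
    omega
  simpa [hn0] using hn

theorem mul_cpow_of_im_pos {w p q : ℂ} (hw : 0 < w.im) (hpq : p.im * q.im < 0)
    (hu : 0 < (w * p * q).im) (s : ℂ) : w ^ s * p ^ s * q ^ s = (w * p * q) ^ s := by
  have hu0 : w * p * q ≠ 0 := fun h => by simp [h] at hu
  rw [cpow_def_of_ne_zero hu0, cpow_def_of_ne_zero (right_ne_zero_of_mul hu0),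
    cpow_def_of_ne_zero (right_ne_zero_of_mul (left_ne_zero_of_mul hu0)),
    cpow_def_of_ne_zero (left_ne_zero_of_mul (left_ne_zero_of_mul hu0)),
    ← log_add_log_add_log_eq_log_mul hw hpq hu, ← exp_add, ← exp_add, add_mul, add_mul]

theorem jfac_im (γ : Matrix.SpecialLinearGroup (Fin 2) ℝ) (z : ℂ) :
    (jfac γ z).im = γ.1 1 0 * z.im := by
  simp [jfac]

theorem moeb_sub_moeb_mul_jfac_mul_jfac (γ : Matrix.SpecialLinearGroup (Fin 2) ℝ) {τ w : ℂ}
    (hτ : jfac γ τ ≠ 0) (hw : jfac γ w ≠ 0) :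
    (moeb γ τ - moeb γ w) * jfac γ τ * jfac γ w = τ - w := by
  have hdet : (γ.1 0 0 : ℂ) * γ.1 1 1 - γ.1 0 1 * γ.1 1 0 = 1 := by
    exact_mod_cast (Matrix.det_fin_two γ.1).symm.trans γ.2
  simp only [moeb]
  field_simp
  simp only [jfac]
  linear_combination (τ - w) * hdet

theorem moeb_im (γ : Matrix.SpecialLinearGroup (Fin 2) ℝ) (z : ℂ) :
    (moeb γ z).im = z.im / normSq (jfac γ z) := by
  have hdet : γ.1 0 0 * γ.1 1 1 - γ.1 0 1 * γ.1 1 0 = 1 :=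
    (Matrix.det_fin_two γ.1).symm.trans γ.2
  rw [moeb, div_im, ← sub_div]
  congr 1
  simp only [jfac, add_re, add_im, re_ofReal_mul, im_ofReal_mul, ofReal_re, ofReal_im]
  linear_combination z.im * hdet

/-- For `γ = (a b; c d) ∈ SL₂(ℝ)` with `c ≠ 0`, `r ∈ ℝ` and `τ, z ∈ ℍ`:
`(γτ - γz̄)^(-r) * (cτ + d)^(-r) * (cz̄ + d)^(-r) = (τ - z̄)^(-r)`,
with all powers principal powers. -/
theorem principal_power_moebius_identity
    (γ : Matrix.SpecialLinearGroup (Fin 2) ℝ) (hc : γ.1 1 0 ≠ 0)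
    (r : ℝ) (τ z : ℂ) (hτ : 0 < τ.im) (hz : 0 < z.im) :
    (moeb γ τ - moeb γ ((starRingEnd ℂ) z)) ^ (-(r : ℂ)) *
        jfac γ τ ^ (-(r : ℂ)) * jfac γ ((starRingEnd ℂ) z) ^ (-(r : ℂ)) =
      (τ - (starRingEnd ℂ) z) ^ (-(r : ℂ)) := by
  have hτim : (jfac γ τ).im ≠ 0 := by
    rw [jfac_im]
    exact mul_ne_zero hc hτ.ne'
  have hzim : (jfac γ ((starRingEnd ℂ) z)).im ≠ 0 := by
    rw [jfac_im, conj_im]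
    exact mul_ne_zero hc (neg_ne_zero.2 hz.ne')
  have hτ0 : jfac γ τ ≠ 0 := fun h => hτim (by simp [h])
  have hz0 : jfac γ ((starRingEnd ℂ) z) ≠ 0 := fun h => hzim (by simp [h])
  have hmul := moeb_sub_moeb_mul_jfac_mul_jfac γ hτ0 hz0
  rw [← hmul]
  apply mul_cpow_of_im_pos
  · rw [sub_im, moeb_im, moeb_im, conj_im, neg_div, sub_neg_eq_add]
    have := normSq_pos.2 hτ0
    have := normSq_pos.2 hz0
    positivity
  · rw [jfac_im, jfac_im, conj_im]
    have := mul_pos (sq_pos_of_ne_zero hc) (mul_pos hτ hz)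
    linarith
  · rw [hmul, sub_im, conj_im, sub_neg_eq_add]
    exact add_pos hτ hz

end
end

section
/- Let r ∈ ℝ, let γ ∈ SL₂(ℝ), let v ∈ ℂ, and let g : ℍ → ℂ be continuously differentiable as a function of two real variables. Suppose the function z ↦ v̄·j(γ, z)^{−r}·g(γz) − g(z) is holomorphic on ℍ. Then for all z ∈ ℍ, (∂g/∂z̄)(z) = v̄·j(γ, z)^{−r}·j(γ, z̄)^{−2}·(∂g/∂z̄)(γz), where ∂/∂z̄ = (1/2)(∂/∂x + i·∂/∂y) is the Wirtinger derivative and z̄ is the complex conjugate of z. -/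
open Complex

noncomputable section

/-- The Wirtinger derivative `∂f/∂z̄ = (1/2)(∂f/∂x + i ∂f/∂y)`, expressed via
the real Fréchet derivative of `f : ℂ → ℂ` regarded as a function of two real
variables. -/
def wirtingerBar (f : ℂ → ℂ) (z : ℂ) : ℂ :=
  (1 / 2 : ℂ) * (fderiv ℝ f z 1 + Complex.I * fderiv ℝ f z Complex.I)

theorem wirtingerBar_eq_zero {f : ℂ → ℂ} {z : ℂ} (hf : DifferentiableAt ℂ f z) :
    wirtingerBar f z = 0 := by
  have h := hf.hasDerivAt.complexToReal_fderiv.fderiv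
  simp only [wirtingerBar, h, smul_apply, one_apply_eq_self,
    smul_eq_mul]
  linear_combination (deriv f z / 2) * Complex.I_sq

theorem wirtingerBar_sub {f g : ℂ → ℂ} {z : ℂ} (hf : DifferentiableAt ℝ f z)
    (hg : DifferentiableAt ℝ g z) :
    wirtingerBar (fun w => f w - g w) z = wirtingerBar f z - wirtingerBar g z := by
  simp only [wirtingerBar, fderiv_fun_sub hf hg, sub_apply]
  ring

theorem wirtingerBar_mul {f g : ℂ → ℂ} {z : ℂ} (hf : DifferentiableAt ℝ f z)
    (hg : DifferentiableAt ℝ g z) :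
    wirtingerBar (fun w => f w * g w) z = f z * wirtingerBar g z + g z * wirtingerBar f z := by
  simp only [wirtingerBar, fderiv_fun_mul hf hg, add_apply,
    smul_apply, smul_eq_mul]
  ring

/-- Chain rule for `∂/∂z̄` of the composition with a holomorphic inner function. -/
theorem wirtingerBar_comp {g m : ℂ → ℂ} {z m' : ℂ} (hg : DifferentiableAt ℝ g (m z))
    (hm : HasDerivAt m m' z) :
    wirtingerBar (fun w => g (m w)) z = (starRingEnd ℂ) m' * wirtingerBar g (m z) := by
  have h := (hg.hasFDerivAt.comp z hm.complexToReal_fderiv).fderiv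
  have lin : ∀ x y : ℝ, fderiv ℝ g (m z) (x + y * Complex.I) =
      x * fderiv ℝ g (m z) 1 + y * fderiv ℝ g (m z) Complex.I := by
    intro x y
    have e : (x + y * Complex.I : ℂ) = x • (1 : ℂ) + y • Complex.I := by simp
    rw [e, map_add, map_smul, map_smul, Complex.real_smul, Complex.real_smul]
  have h1 : fderiv ℝ (fun w => g (m w)) z 1 =
      m'.re * fderiv ℝ g (m z) 1 + m'.im * fderiv ℝ g (m z) Complex.I := by
    rw [← lin, Complex.re_add_im]
    change fderiv ℝ (g ∘ m) z 1 = _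
    rw [h]
    simp
  have hI : fderiv ℝ (fun w => g (m w)) z Complex.I =
      (-m'.im : ℝ) * fderiv ℝ g (m z) 1 + m'.re * fderiv ℝ g (m z) Complex.I := by
    rw [← lin]
    change fderiv ℝ (g ∘ m) z Complex.I = _
    rw [h]
    simp only [ContinuousLinearMap.comp_apply, smul_apply,
      one_apply_eq_self, smul_eq_mul]
    congr 1
    apply Complex.ext <;> simp
  have hc : (starRingEnd ℂ) m' = m'.re - m'.im * Complex.I := by
    apply Complex.ext <;> simp
  simp only [wirtingerBar]
  rw [h1, hI, hc]
  push_cast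
  linear_combination (m'.im / 2 * fderiv ℝ g (m z) Complex.I : ℂ) * Complex.I_sq

theorem jfac_ne_zero (γ : Matrix.SpecialLinearGroup (Fin 2) ℝ) {z : ℂ} (hz : 0 < z.im) :
    jfac γ z ≠ 0 := by
  intro h
  have hdet := γ.2
  rw [Matrix.det_fin_two] at hdet
  have him := congrArg Complex.im h
  have hre := congrArg Complex.re h
  simp only [jfac, Complex.add_im, Complex.add_re, Complex.im_ofReal_mul, Complex.re_ofReal_mul,
    Complex.ofReal_im, Complex.ofReal_re, Complex.zero_im, Complex.zero_re, add_zero] at him hre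
  have hc : γ.1 1 0 = 0 := (mul_eq_zero.mp him).resolve_right hz.ne'
  have hd : γ.1 1 1 = 0 := by simpa [hc] using hre
  simp [hc, hd] at hdet

theorem hasDerivAt_jfac (γ : Matrix.SpecialLinearGroup (Fin 2) ℝ) (z : ℂ) :
    HasDerivAt (jfac γ) (γ.1 1 0 : ℝ) z := by
  have h := ((hasDerivAt_id z).const_mul ((γ.1 1 0 : ℝ) : ℂ)).add_const ((γ.1 1 1 : ℝ) : ℂ)
  rw [mul_one] at h
  exact h

theorem det_eq_one_complex (γ : Matrix.SpecialLinearGroup (Fin 2) ℝ) :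
    ((γ.1 0 0 : ℝ) : ℂ) * (γ.1 1 1 : ℝ) - (γ.1 0 1 : ℝ) * (γ.1 1 0 : ℝ) = 1 := by
  have hdet := γ.2
  rw [Matrix.det_fin_two] at hdet
  exact_mod_cast hdet

theorem hasDerivAt_moeb (γ : Matrix.SpecialLinearGroup (Fin 2) ℝ) {z : ℂ} (hz : jfac γ z ≠ 0) :
    HasDerivAt (moeb γ) (jfac γ z ^ (-2 : ℤ)) z := by
  have hnum : HasDerivAt (fun w : ℂ => ((γ.1 0 0 : ℝ) : ℂ) * w + (γ.1 0 1 : ℝ))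
      (γ.1 0 0 : ℝ) z := by
    simpa using ((hasDerivAt_id z).const_mul ((γ.1 0 0 : ℝ) : ℂ)).add_const
      ((γ.1 0 1 : ℝ) : ℂ)
  refine (hnum.div (hasDerivAt_jfac γ z) hz).congr_deriv ?_
  rw [zpow_neg, div_eq_mul_inv]
  norm_cast
  conv_rhs => rw [← one_mul (jfac γ z ^ 2)⁻¹]
  congr 1
  simp only [jfac]
  linear_combination det_eq_one_complex γ

theorem moeb_im_pos (γ : Matrix.SpecialLinearGroup (Fin 2) ℝ) {z : ℂ} (hz : 0 < z.im) :
    0 < (moeb γ z).im := by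
  have hdet := γ.2
  rw [Matrix.det_fin_two] at hdet
  have hn := Complex.normSq_pos.mpr (jfac_ne_zero γ hz)
  have key : (moeb γ z).im = z.im / Complex.normSq (jfac γ z) := by
    rw [moeb, Complex.div_im, ← sub_div]
    congr 1
    simp only [jfac, Complex.add_im, Complex.add_re, Complex.im_ofReal_mul,
      Complex.re_ofReal_mul, Complex.ofReal_im, Complex.ofReal_re, add_zero]
    linear_combination z.im * hdet
  rw [key]
  positivity

theorem differentiableAt_jfac_cpow (γ : Matrix.SpecialLinearGroup (Fin 2) ℝ) (s : ℂ) {z : ℂ}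
    (hz : 0 < z.im) : DifferentiableAt ℂ (fun w => jfac γ w ^ s) z := by
  by_cases hc : γ.1 1 0 = 0
  · simp [jfac, hc]
  · refine (hasDerivAt_jfac γ z).differentiableAt.cpow_const (Or.inr ?_)
    simp [jfac, hc, hz.ne']

theorem conj_jfac (γ : Matrix.SpecialLinearGroup (Fin 2) ℝ) (z : ℂ) :
    (starRingEnd ℂ) (jfac γ z) = jfac γ ((starRingEnd ℂ) z) := by
  simp [jfac]

/-- If `g : ℍ → ℂ` is continuously differentiable as a function of two real
variables and `z ↦ v̄ j(γ,z)^(-r) g(γz) - g(z)` is holomorphic on `ℍ`, then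
`(∂g/∂z̄)(z) = v̄ ⬝ j(γ,z)^(-r) ⬝ j(γ,z̄)^(-2) ⬝ (∂g/∂z̄)(γz)` on `ℍ`. -/
theorem wirtinger_coboundary_transform (r : ℝ)
    (γ : Matrix.SpecialLinearGroup (Fin 2) ℝ) (v : ℂ) (g : ℂ → ℂ)
    (hg : ContDiffOn ℝ 1 g {z : ℂ | 0 < z.im})
    (hol : DifferentiableOn ℂ
      (fun z => (starRingEnd ℂ) v * jfac γ z ^ (-(r : ℂ)) * g (moeb γ z) - g z)
      {z : ℂ | 0 < z.im}) :
    ∀ z : ℂ, 0 < z.im →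
      wirtingerBar g z =
        (starRingEnd ℂ) v * jfac γ z ^ (-(r : ℂ)) *
          jfac γ ((starRingEnd ℂ) z) ^ (-2 : ℤ) * wirtingerBar g (moeb γ z) := by
  intro z hz
  have hopen : IsOpen {z : ℂ | 0 < z.im} := isOpen_lt continuous_const Complex.continuous_im
  have hgd : ∀ w : ℂ, 0 < w.im → DifferentiableAt ℝ g w := fun w hw =>
    (hg.differentiableOn one_ne_zero).differentiableAt (hopen.mem_nhds hw)
  have hm := hasDerivAt_moeb γ (jfac_ne_zero γ hz)
  have hgm := hgd _ (moeb_im_pos γ hz)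
  have hcomp : DifferentiableAt ℝ (fun w => g (moeb γ w)) z :=
    hgm.comp z (hm.differentiableAt.restrictScalars ℝ)
  have hH : DifferentiableAt ℂ (fun w => (starRingEnd ℂ) v * jfac γ w ^ (-(r : ℂ))) z :=
    (differentiableAt_jfac_cpow γ _ hz).const_mul _
  have hHr := hH.restrictScalars ℝ
  have h0 := wirtingerBar_eq_zero (hol.differentiableAt (hopen.mem_nhds hz))
  rw [wirtingerBar_sub (hHr.fun_mul hcomp) (hgd z hz), wirtingerBar_mul hHr hcomp,
    wirtingerBar_eq_zero hH, wirtingerBar_comp hgm hm, map_zpow₀, conj_jfac] at h0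
  linear_combination -h0

end
end
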